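/- Let l be a positive integer, let k ≥ 2, and let T = (V, E) be an edge-coloured tournament containing no l-flash and no k-rainbow with |V| ≥ t(l,k-1) + g(l,k,k-2) + 2(k-1)·(t(l,k-1) + 2(k-1)·l·t(l,k-2)) + 2. Then T contains a strongly (k-2)-robust vertex. -/

import Mathlib

/-- `r` is a tournament relation on `Fin n`: an orientation of the complete graph,
i.e. irreflexive and, for distinct vertices, exactly one direction is present. -/
def IsTournament {n : ℕ} (r : Fin n → Fin n → Prop) : Prop :=
  (∀ v, ¬ r v v) ∧ ∀ u v : Fin n, u ≠ v → (r u v ↔ ¬ r v u)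

/-- `x` is a directed walk (of length `m`) in the digraph `r`;
vertices and edges may repeat. -/
def IsWalk {n m : ℕ} (r : Fin n → Fin n → Prop) (x : Fin (m + 1) → Fin n) : Prop :=
  ∀ i : Fin m, r (x i.castSucc) (x i.succ)

/-- The sequence of colours along a sequence of `m + 1` vertices. -/
def walkColours {n m : ℕ} {α : Type} (c : Fin n → Fin n → α) (x : Fin (m + 1) → Fin n) :
    Fin m → α :=
  fun i => c (x i.castSucc) (x i.succ)

/-- The edge-coloured digraph `(r, c)` contains an `l`-flash: a directed walk of
length `l` all of whose edges have the same colour. -/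
def HasFlash {n : ℕ} {α : Type} (l : ℕ) (r : Fin n → Fin n → Prop)
    (c : Fin n → Fin n → α) : Prop :=
  ∃ x : Fin (l + 1) → Fin n, IsWalk r x ∧
    ∀ i j : Fin l, walkColours c x i = walkColours c x j

/-- The edge-coloured digraph `(r, c)` contains a `k`-rainbow: a directed walk of
length `k` whose edge colours are pairwise distinct. -/
def HasRainbow {n : ℕ} {α : Type} (k : ℕ) (r : Fin n → Fin n → Prop)
    (c : Fin n → Fin n → α) : Prop :=
  ∃ y : Fin (k + 1) → Fin n, IsWalk r y ∧ Function.Injective (walkColours c y)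

/-- The set of `m` such that every edge colouring of any tournament with more than `m`
vertices contains an `l`-flash or a `k`-rainbow. -/
def tSet (l k : ℕ) : Set ℕ :=
  {m | ∀ n : ℕ, n > m → ∀ r : Fin n → Fin n → Prop, IsTournament r →
    ∀ (α : Type) (c : Fin n → Fin n → α), HasFlash l r c ∨ HasRainbow k r c}

/-- `t l k` is the smallest integer such that every edge colouring of any tournament
with more than `t l k` vertices contains an `l`-flash or a `k`-rainbow. -/
noncomputable def t (l k : ℕ) : ℕ := sInf (tSet l k)
/-- The edge colouring `c` of the complete graph on `Fin n` contains a monotone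
`l`-flash: vertices `x 0 < x 1 < ⋯ < x l` whose consecutive edges all get the
same colour. -/
def HasMonoFlash {n : ℕ} {α : Type} (l : ℕ) (c : Fin n → Fin n → α) : Prop :=
  ∃ x : Fin (l + 1) → Fin n, StrictMono x ∧
    ∀ i j : Fin l, walkColours c x i = walkColours c x j

/-- The edge colouring `c` of the complete graph on `Fin n` contains a monotone
`k`-rainbow: vertices `y 0 < y 1 < ⋯ < y k` whose consecutive edges get pairwise
distinct colours. -/
def HasMonoRainbow {n : ℕ} {α : Type} (k : ℕ) (c : Fin n → Fin n → α) : Prop :=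
  ∃ y : Fin (k + 1) → Fin n, StrictMono y ∧ Function.Injective (walkColours c y)

/-- The set of `m` such that for every `n > m`, every colouring of the edges of the
complete graph on `n` vertices (with an arbitrary set of colours) contains a
monotone `l`-flash or a monotone `k`-rainbow. -/
def fSet (l k : ℕ) : Set ℕ :=
  {m | ∀ n : ℕ, n > m → ∀ (α : Type) (c : Fin n → Fin n → α),
    HasMonoFlash l c ∨ HasMonoRainbow k c}

/-- `f l k` is the smallest integer such that for every `n > f l k`, every colouring
of the edges of the complete graph on `n` vertices contains a monotone `l`-flash or
a monotone `k`-rainbow. -/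
noncomputable def f (l k : ℕ) : ℕ := sInf (fSet l k)
/-- The set of colours on edges directed out of `v`. -/
def outColours {n : ℕ} {α : Type} (r : Fin n → Fin n → Prop) (c : Fin n → Fin n → α)
    (v : Fin n) : Set α :=
  {a | ∃ u, r v u ∧ c v u = a}

/-- A vertex `v` is `rb`-in-robust if for every colour `a` there is an `rb`-rainbow
avoiding colour `a` that ends at `v`. -/
def IsInRobust {n : ℕ} {α : Type} (rb : ℕ) (r : Fin n → Fin n → Prop)
    (c : Fin n → Fin n → α) (v : Fin n) : Prop :=
  ∀ a : α, ∃ y : Fin (rb + 1) → Fin n, IsWalk r y ∧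
    Function.Injective (walkColours c y) ∧ (∀ i, walkColours c y i ≠ a) ∧
    y (Fin.last rb) = v

/-- The set of `m` such that every tournament with more than `m` vertices, coloured
with at most `k - 1` outgoing colours at each vertex, contains an `l`-flash, a
`k`-rainbow, or an `rb`-in-robust vertex. -/
def gSet (l k rb : ℕ) : Set ℕ :=
  {m | ∀ n : ℕ, n > m → ∀ r : Fin n → Fin n → Prop, IsTournament r →
    ∀ (α : Type) (c : Fin n → Fin n → α),
      (∀ v, (outColours r c v).ncard ≤ k - 1) →
      HasFlash l r c ∨ HasRainbow k r c ∨ ∃ v, IsInRobust rb r c v}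

/-- `g l k rb` is the smallest integer such that every tournament with more than
`g l k rb` vertices, coloured with at most `k - 1` outgoing colours at each vertex,
contains an `l`-flash, a `k`-rainbow, or an `rb`-in-robust vertex. -/
noncomputable def g (l k rb : ℕ) : ℕ := sInf (gSet l k rb)
/-- A vertex `v` is strongly `(k-2)`-robust if there is a set `C` of `k - 1` colours
containing every colour incident to `v` such that for every `a ∈ C` there is a
`(k-2)`-rainbow with colour set exactly `C \ {a}` ending at `v`, and also one
starting at `v`. -/
def IsStronglyRobust {n : ℕ} {α : Type} (k : ℕ) (r : Fin n → Fin n → Prop)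
    (c : Fin n → Fin n → α) (v : Fin n) : Prop :=
  ∃ C : Finset α, C.card = k - 1 ∧
    (∀ u : Fin n, (r u v → c u v ∈ C) ∧ (r v u → c v u ∈ C)) ∧
    ∀ a ∈ C,
      (∃ y : Fin (k - 2 + 1) → Fin n, IsWalk r y ∧
        Function.Injective (walkColours c y) ∧
        Set.range (walkColours c y) = ↑C \ {a} ∧ y (Fin.last (k - 2)) = v) ∧
      (∃ y : Fin (k - 2 + 1) → Fin n, IsWalk r y ∧
        Function.Injective (walkColours c y) ∧
        Set.range (walkColours c y) = ↑C \ {a} ∧ y 0 = v)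


open Classical in
/-- `RW r c L v w`: there is a directed walk from `v` to `w` with list of colours `L`. -/
def RW {n : ℕ} {α : Type} (r : Fin n → Fin n → Prop) (c : Fin n → Fin n → α) :
    List α → Fin n → Fin n → Prop
  | [], v, w => v = w
  | a :: L, v, w => ∃ u, r v u ∧ c v u = a ∧ RW r c L u w

section helpers
variable {n : ℕ} {α : Type} {r : Fin n → Fin n → Prop} {c : Fin n → Fin n → α}

lemma RW_append (L M : List α) (v w : Fin n) :
    RW r c (L ++ M) v w ↔ ∃ u, RW r c L v u ∧ RW r c M u w := by
  induction L generalizing v with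
  | nil => simp [RW]
  | cons a L ih =>
    simp only [List.cons_append, RW, ih]
    constructor
    · rintro ⟨u, h1, h2, x, h3, h4⟩
      exact ⟨x, ⟨u, h1, h2, h3⟩, h4⟩
    · rintro ⟨x, ⟨u, h1, h2, h3⟩, h4⟩
      exact ⟨u, h1, h2, x, h3, h4⟩

lemma RW_of_walk {m : ℕ} (y : Fin (m + 1) → Fin n) (h : IsWalk r y) :
    RW r c (List.ofFn (walkColours c y)) (y 0) (y (Fin.last m)) := by
  induction m with
  | zero => simp [RW]
  | succ m ih =>
    rw [List.ofFn_succ]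
    refine ⟨y 1, h 0, rfl, ?_⟩
    exact ih (fun i => y i.succ) (fun i => h i.succ)

lemma walk_of_RW {m : ℕ} (L : List α) (hL : L.length = m) (v w : Fin n) (h : RW r c L v w) :
    ∃ y : Fin (m + 1) → Fin n, IsWalk r y ∧ List.ofFn (walkColours c y) = L ∧
      y 0 = v ∧ y (Fin.last m) = w := by
  induction L generalizing v m with
  | nil =>
    subst hL
    exact ⟨fun _ => v, fun i => i.elim0, by simp, rfl, h⟩
  | cons a L ih =>
    subst hL
    obtain ⟨u, h1, h2, h3⟩ := h
    obtain ⟨y, hy1, hy2, hy3, hy4⟩ := ih rfl u h3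
    refine ⟨Fin.cons v y, ?_, ?_, rfl, ?_⟩
    · intro i
      refine Fin.cases ?_ (fun j => ?_) i
      · simpa [hy3] using h1
      · have := hy1 j
        simpa [← Fin.succ_castSucc] using this
    · refine Eq.trans (List.ofFn_succ) ?_
      refine congrArg₂ List.cons ?_ ?_
      · show c v (y 0) = a
        rw [hy3, h2]
      · exact hy2
    · simpa [← Fin.succ_last] using hy4

lemma HasRainbow_of_RW {k : ℕ} {L : List α} {v w : Fin n} (h : RW r c L v w)
    (hL : L.length = k) (hd : L.Nodup) : HasRainbow k r c := by
  obtain ⟨y, hy1, hy2, -, -⟩ := walk_of_RW L hL v w h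
  exact ⟨y, hy1, List.nodup_ofFn.1 (hy2 ▸ hd)⟩

lemma HasFlash_of_RW {l : ℕ} {a : α} {v w : Fin n} (h : RW r c (List.replicate l a) v w) :
    HasFlash l r c := by
  obtain ⟨y, hy1, hy2, -, -⟩ := walk_of_RW _ (List.length_replicate) v w h
  have : ∀ i, walkColours c y i = a := by
    intro i
    have : walkColours c y i ∈ List.ofFn (walkColours c y) := by simp [List.mem_ofFn]
    rw [hy2] at this
    exact List.eq_of_mem_replicate this
  exact ⟨y, hy1, fun i j => by rw [this, this]⟩

lemma sub_tournament (hT : IsTournament r) {m : ℕ} (e : Fin m ↪ Fin n) :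
    IsTournament (fun i j => r (e i) (e j)) :=
  ⟨fun v => hT.1 _, fun u v huv => hT.2 _ _ (fun h => huv (e.injective h))⟩

lemma sub_flash {l m : ℕ} (e : Fin m ↪ Fin n)
    (h : HasFlash l (fun i j => r (e i) (e j)) (fun i j => c (e i) (e j))) : HasFlash l r c := by
  obtain ⟨x, h1, h2⟩ := h
  exact ⟨fun i => e (x i), h1, h2⟩

lemma sub_rainbow {l m : ℕ} (e : Fin m ↪ Fin n)
    (h : HasRainbow l (fun i j => r (e i) (e j)) (fun i j => c (e i) (e j))) :
    HasRainbow l r c := by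
  obtain ⟨x, h1, h2⟩ := h
  exact ⟨fun i => e (x i), h1, h2⟩

lemma sub_t {l k m : ℕ} (hm : m ∈ tSet l k) (hT : IsTournament r) (hf : ¬ HasFlash l r c)
    (W : Finset (Fin n)) (hW : m < W.card) :
    ∃ y : Fin (k + 1) → Fin n, IsWalk r y ∧ Function.Injective (walkColours c y) ∧
      ∀ i, y i ∈ W := by
  let e : Fin W.card ↪ Fin n := (W.orderEmbOfFin rfl).toEmbedding
  rcases hm W.card hW _ (sub_tournament hT e) α (fun i j => c (e i) (e j)) with h | h
  · exact absurd (sub_flash e h) hf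
  · obtain ⟨x, h1, h2⟩ := h
    exact ⟨fun i => e (x i), h1, h2, fun i => Finset.orderEmbOfFin_mem W rfl (x i)⟩

lemma outColours_finite (v : Fin n) : (outColours r c v).Finite := by
  have : outColours r c v ⊆ Set.range (fun u => c v u) := by
    rintro a ⟨u, hu, rfl⟩
    exact ⟨u, rfl⟩
  exact (Set.finite_range _).subset this

lemma sub_g {l k rb m : ℕ} (hm : m ∈ gSet l k rb) (hT : IsTournament r) (hf : ¬ HasFlash l r c)
    (hr : ¬ HasRainbow k r c) (W : Finset (Fin n)) (hW : m < W.card)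
    (ho : ∀ v ∈ W, (outColours r c v).ncard ≤ k - 1) :
    ∃ v ∈ W, IsInRobust rb r c v := by
  let e : Fin W.card ↪ Fin n := (W.orderEmbOfFin rfl).toEmbedding
  have he : ∀ i, e i ∈ W := fun i => Finset.orderEmbOfFin_mem W rfl i
  have ho' : ∀ v, (outColours (fun i j => r (e i) (e j)) (fun i j => c (e i) (e j)) v).ncard
      ≤ k - 1 := by
    intro v
    refine le_trans (Set.ncard_le_ncard ?_ (outColours_finite _)) (ho (e v) (he v))
    rintro a ⟨u, hu, rfl⟩
    exact ⟨e u, hu, rfl⟩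
  rcases hm W.card hW _ (sub_tournament hT e) α (fun i j => c (e i) (e j)) ho' with
    h | h | h
  · exact absurd (sub_flash e h) hf
  · exact absurd (sub_rainbow e h) hr
  · obtain ⟨v, hv⟩ := h
    refine ⟨e v, he v, fun a => ?_⟩
    obtain ⟨y, h1, h2, h3, h4⟩ := hv a
    exact ⟨fun i => e (y i), h1, h2, h3, congrArg e h4⟩

open Classical in
lemma exists_big_out (hT : IsTournament r) (R : Finset (Fin n)) (hR : R.Nonempty) :
    ∃ v ∈ R, R.card ≤ 2 * (R.filter (fun u => r v u)).card + 1 := by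
  by_contra! hcon
  have hsum : ∑ v ∈ R, (R.filter (fun u => r v u)).card
      = ∑ v ∈ R, (R.filter (fun u => r u v)).card :=
    Finset.sum_card_bipartiteAbove_eq_sum_card_bipartiteBelow r
  have heach : ∀ v ∈ R, (R.filter (fun u => r v u)).card + (R.filter (fun u => r u v)).card + 1
      = R.card := by
    intro v hv
    rw [← Finset.card_erase_add_one hv]
    congr 1
    rw [← Finset.card_union_of_disjoint]
    · congr 1
      ext u
      simp only [Finset.mem_union, Finset.mem_filter, Finset.mem_erase]
      constructor
      · rintro (⟨h1, h2⟩ | ⟨h1, h2⟩)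
        · exact ⟨fun h => hT.1 v (h ▸ h2), h1⟩
        · exact ⟨fun h => hT.1 v (h ▸ h2), h1⟩
      · rintro ⟨h1, h2⟩
        have := hT.2 u v h1
        tauto
    · rw [Finset.disjoint_left]
      intro u h1 h2
      simp only [Finset.mem_filter] at h1 h2
      by_cases h : u = v
      · exact hT.1 v (h ▸ h1.2)
      · exact (hT.2 u v h).1 h2.2 h1.2
  have hlt : ∑ v ∈ R, (2 * (R.filter (fun u => r v u)).card + 1) < ∑ v ∈ R, R.card :=
    Finset.sum_lt_sum_of_nonempty hR hcon
  rw [← Finset.sum_congr rfl heach] at hlt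
  simp only [Finset.sum_add_distrib, ← Finset.mul_sum] at hlt
  omega

open Classical in
lemma exists_mono_star (hT : IsTournament r) (R : Finset (Fin n)) (d X : ℕ)
    (ho : ∀ v ∈ R, (outColours r c v).ncard ≤ d) (hc : 2 * d * X + 1 < R.card) :
    ∃ v ∈ R, ∃ a, ∃ N ⊆ R, X < N.card ∧ ∀ u ∈ N, r v u ∧ c v u = a := by
  obtain ⟨v, hv, hd⟩ := exists_big_out hT R (Finset.card_pos.1 (by omega))
  have h1 : d * X < (R.filter (fun u => r v u)).card := by
    rw [mul_assoc] at hc; omega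
  have hfin := outColours_finite (r := r) (c := c) v
  have h2 : hfin.toFinset.card * X < (R.filter (fun u => r v u)).card := by
    refine lt_of_le_of_lt (Nat.mul_le_mul_right _ ?_) h1
    rw [← Set.ncard_eq_toFinset_card _ hfin]
    exact ho v hv
  obtain ⟨a, ha, hX⟩ := Finset.exists_lt_card_fiber_of_mul_lt_card_of_maps_to
    (f := fun u => c v u) (t := hfin.toFinset) (by
      intro u hu
      simp only [Finset.mem_filter] at hu
      simp only [Set.Finite.mem_toFinset]
      exact ⟨u, hu.2, rfl⟩) h2
  refine ⟨v, hv, a, _, ?_, hX, ?_⟩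
  · exact (Finset.filter_subset _ _).trans (Finset.filter_subset _ _)
  · intro u hu
    simp only [Finset.mem_filter] at hu
    exact ⟨hu.1.2, hu.2⟩

/-- Few vertices with many outgoing colours. -/
lemma card_many_out {l k m : ℕ} (hm : m ∈ tSet l k) (hT : IsTournament r)
    (hf : ¬ HasFlash l r c) (hr : ¬ HasRainbow (k + 1) r c) (A : Finset (Fin n))
    (hA : ∀ v ∈ A, k < (outColours r c v).ncard) : A.card ≤ m := by
  by_contra! hcon
  obtain ⟨y, h1, h2, h3⟩ := sub_t hm hT hf A hcon
  have hR := RW_of_walk (c := c) y h1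
  have hlt : (Set.range (walkColours c y)).ncard < (outColours r c (y (Fin.last k))).ncard := by
    refine lt_of_le_of_lt ?_ (hA _ (h3 _))
    rw [← Set.image_univ]
    refine (Set.ncard_image_le).trans ?_
    simp [Set.ncard_univ]
  obtain ⟨a, ⟨u, hu, rfl⟩, ha⟩ := Set.exists_mem_notMem_of_ncard_lt_ncard hlt
  refine hr (HasRainbow_of_RW (L := List.ofFn (walkColours c y) ++ [c (y (Fin.last k)) u])
    (v := y 0) (w := u) ?_ (by simp) ?_)
  · rw [RW_append]
    exact ⟨_, hR, u, hu, rfl, rfl⟩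
  · rw [List.nodup_append]
    refine ⟨List.nodup_ofFn.2 h2, by simp, ?_⟩
    intro b hb d hd
    simp only [List.mem_singleton] at hd
    subst hd
    rintro rfl
    exact ha (by simpa [List.mem_ofFn] using hb)

lemma exists_chain (hT : IsTournament r) (k M : ℕ) (W : Finset (Fin n))
    (ho : ∀ v ∈ W, (outColours r c v).ncard ≤ k) (hW : (2 * k + 2) ^ M ≤ W.card) :
    ∃ L : List (Fin n × α), L.length = M ∧ (∀ p ∈ L, p.1 ∈ W) ∧
      L.Pairwise (fun p q => r p.1 q.1 ∧ c p.1 q.1 = p.2) := by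
  induction M generalizing W with
  | zero => exact ⟨[], by simp⟩
  | succ M ih =>
    have hpos : 0 < (2 * k + 2) ^ M := by positivity
    obtain ⟨v, hv, a, N, hN, hX, hs⟩ := exists_mono_star hT W k ((2 * k + 2) ^ M - 1) ho (by
      refine lt_of_lt_of_le ?_ hW
      rw [pow_succ]
      obtain ⟨Y, hY⟩ : ∃ Y, (2 * k + 2) ^ M = Y + 1 := ⟨_, (Nat.succ_pred_eq_of_pos hpos).symm⟩
      rw [hY]
      simp only [Nat.add_sub_cancel]
      nlinarith)
    obtain ⟨L, h1, h2, h3⟩ := ih N (fun v hv => ho v (hN hv)) (by omega)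
    refine ⟨(v, a) :: L, by simp [h1], ?_, ?_⟩
    · intro p hp
      rcases List.mem_cons.1 hp with rfl | hp
      · exact hv
      · exact hN (h2 p hp)
    · rw [List.pairwise_cons]
      exact ⟨fun p hp => hs _ (h2 p hp), h3⟩

lemma RW_of_chain (m : ℕ) (L : List (Fin n × α)) (hL : m < L.length)
    (hp : L.Pairwise (fun p q => r p.1 q.1 ∧ c p.1 q.1 = p.2)) :
    ∃ v w, RW r c ((L.take m).map Prod.snd) v w ∧ ∀ p ∈ L.head?, p.1 = v := by
  induction m generalizing L with
  | zero =>
    cases L with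
    | nil => simp at hL
    | cons p L => exact ⟨p.1, p.1, by simp [RW], by simp⟩
  | succ m ih =>
    match L, hL, hp with
    | p :: q :: L, hL, hp =>
      obtain ⟨v, w, h1, h2⟩ := ih (q :: L) (by simpa using hL) (List.pairwise_cons.1 hp).2
      have hq : q.1 = v := h2 q (by simp)
      have := (List.pairwise_cons.1 hp).1 q (by simp)
      refine ⟨p.1, w, ⟨v, hq ▸ this.1, hq ▸ this.2, h1⟩, by simp⟩
    | [p], hL, hp => simp at hL
    | [], hL, hp => simp at hL

open Classical in
lemma exists_distinct (l j : ℕ) (L : List (Fin n × α))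
    (h : ∀ a, (L.filter (fun p => p.2 = a)).length ≤ l) (hL : l * j < L.length) :
    ∃ L' : List (Fin n × α), L'.Sublist L ∧ L'.length = j + 1 ∧ (L'.map Prod.snd).Nodup := by
  induction j generalizing L with
  | zero =>
    match L, hL with
    | p :: L, _ => exact ⟨[p], by simp⟩
    | [], hL => simp at hL
  | succ j ih =>
    match L, hL, h with
    | [], hL, _ => simp at hL
    | p :: L, hL, h =>
      have h1 := h p.2
      have hlen := List.length_eq_length_filter_add (l := L) (fun q => decide (q.2 = p.2))
      simp only [List.filter_cons, decide_true, if_true, List.length_cons] at h1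
      rw [List.length_cons, mul_add] at hL
      obtain ⟨L', hs, hl, hn⟩ := ih (L.filter (fun q => !decide (q.2 = p.2))) (by
        intro a
        refine le_trans (List.Sublist.length_le ?_) (h a)
        exact List.Sublist.filter _ ((List.filter_sublist).trans (List.sublist_cons_self _ _)))
        (by omega)
      refine ⟨p :: L', (hs.trans List.filter_sublist).cons_cons p, by simp [hl], ?_⟩
      rw [List.map_cons, List.nodup_cons]
      refine ⟨?_, hn⟩
      intro hmem
      obtain ⟨q, hq, hqp⟩ := List.mem_map.1 hmem
      have := hs.subset hq
      simp [hqp] at this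

end helpers

open Classical in
lemma tSet_nonempty (l k : ℕ) : (tSet l k).Nonempty := by
  induction k with
  | zero =>
    refine ⟨0, fun n hn r hT α c => Or.inr ?_⟩
    exact ⟨fun _ => ⟨0, hn⟩, fun i => i.elim0, fun i => i.elim0⟩
  | succ k ih =>
    obtain ⟨m, hm⟩ := ih
    refine ⟨m + (2 * k + 2) ^ (l * (k + 1) + 1), fun n hn r hT α c => ?_⟩
    by_contra! hcon
    obtain ⟨hf, hr⟩ := hcon
    set A := Finset.univ.filter (fun v => k < (outColours r c v).ncard) with hA
    have hAc : A.card ≤ m := card_many_out hm hT hf hr A (by simp [hA])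
    have hcard : A.card +
        (Finset.univ.filter (fun v => ¬ k < (outColours r c v).ncard)).card = n := by
      have := Finset.card_filter_add_card_filter_not (s := (Finset.univ : Finset (Fin n)))
        (fun v => k < (outColours r c v).ncard)
      rw [Finset.card_univ, Fintype.card_fin] at this
      rw [hA]
      convert this
    obtain ⟨L, h1, -, h3⟩ := exists_chain (c := c) hT k (l * (k + 1) + 1)
      (Finset.univ.filter (fun v => ¬ k < (outColours r c v).ncard)) (by simp) (by omega)
    have hcol : ∀ a, (L.filter (fun p => p.2 = a)).length ≤ l := by
      intro a
      by_contra! hlt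
      obtain ⟨v, w, hvw, -⟩ := RW_of_chain l _ hlt (h3.sublist List.filter_sublist)
      have : ((L.filter (fun p => p.2 = a)).take l).map Prod.snd = List.replicate l a := by
        rw [List.eq_replicate_iff]
        refine ⟨by simp; omega, ?_⟩
        intro b hb
        obtain ⟨p, hp, rfl⟩ := List.mem_map.1 hb
        have := List.mem_of_mem_take hp
        simpa using (List.mem_filter.1 this).2
      rw [this] at hvw
      exact hf (HasFlash_of_RW hvw)
    obtain ⟨L', hs, hl, hnd⟩ := exists_distinct l (k + 1) L hcol (by omega)
    obtain ⟨v, w, hvw, -⟩ := RW_of_chain (k + 1) L' (by omega) (h3.sublist hs)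
    refine hr (HasRainbow_of_RW hvw (by simp [hl]) ?_)
    exact hnd.sublist ((List.take_sublist _ _).map _)

lemma t_mem (l k : ℕ) : t l k ∈ tSet l k := Nat.sInf_mem (tSet_nonempty l k)

lemma g_mem (l k rb : ℕ) : g l k rb ∈ gSet l k rb := by
  apply Nat.sInf_mem
  obtain ⟨m, hm⟩ := tSet_nonempty l k
  exact ⟨m, fun n hn r hT α c _ => by
    rcases hm n hn r hT α c with h | h
    · exact Or.inl h
    · exact Or.inr (Or.inl h)⟩

open Classical in
/-- A set without rainbow avoiding `a` is small. -/
lemma sub_avoid {n : ℕ} {α : Type} {r : Fin n → Fin n → Prop} {c : Fin n → Fin n → α}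
    {l k : ℕ} (hT : IsTournament r) (hf : ¬ HasFlash l r c)
    (a : α) (B : Finset (Fin n)) (hB : l * t l k < B.card) :
    ∃ y : Fin (k + 1) → Fin n, IsWalk r y ∧ Function.Injective (walkColours c y) ∧
      (∀ i, y i ∈ B) ∧ ∀ i, walkColours c y i ≠ a := by
  let P : Fin n → ℕ → Prop := fun u m => ∃ w, RW r c (List.replicate m a) u w
  let h : Fin n → ℕ := fun u => Nat.findGreatest (P u) l
  have hP : ∀ u, P u (h u) := fun u =>
    Nat.findGreatest_spec (P := P u) (Nat.zero_le l) ⟨u, rfl⟩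
  have hlt : ∀ u, h u < l := by
    intro u
    refine lt_of_le_of_ne (Nat.findGreatest_le l) (fun he => ?_)
    have := hP u
    rw [he] at this
    obtain ⟨w, hw⟩ := this
    exact hf (HasFlash_of_RW hw)
  have hmono : ∀ u v, r u v → c u v = a → h v < h u := by
    intro u v huv hc
    have : P u (h v + 1) := by
      obtain ⟨w, hw⟩ := hP v
      exact ⟨w, v, huv, hc, hw⟩
    exact Nat.le_findGreatest (hlt v) this
  obtain ⟨j, hj, hX⟩ := Finset.exists_lt_card_fiber_of_mul_lt_card_of_maps_to
    (f := h) (t := Finset.range l) (s := B) (n := t l k)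
    (fun u _ => Finset.mem_range.2 (hlt u)) (by simpa using hB)
  obtain ⟨y, h1, h2, h3⟩ := sub_t (t_mem l k) hT hf _ hX
  simp only [Finset.mem_filter] at h3
  refine ⟨y, h1, h2, fun i => (h3 i).1, fun i hi => ?_⟩
  have := hmono _ _ (h1 i) hi
  rw [(h3 _).2, (h3 _).2] at this
  exact lt_irrefl _ this

/-- If k ≥ 2 and an edge-coloured tournament contains no l-flash and no k-rainbow and
has at least t(l,k-1) + g(l,k,k-2) + 2(k-1)(t(l,k-1) + 2(k-1)·l·t(l,k-2)) + 2
vertices, then it contains a strongly (k-2)-robust vertex. -/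
theorem exists_strongly_robust (l k n : ℕ) (hl : 0 < l) (hk : 2 ≤ k)
    (r : Fin n → Fin n → Prop) (α : Type) (c : Fin n → Fin n → α)
    (hT : IsTournament r) (hf : ¬ HasFlash l r c) (hrb : ¬ HasRainbow k r c)
    (hn : n ≥ t l (k - 1) + g l k (k - 2) +
      2 * (k - 1) * (t l (k - 1) + 2 * (k - 1) * l * t l (k - 2)) + 2) :
    ∃ v, IsStronglyRobust k r c v := by
  classical
  obtain ⟨q, rfl⟩ : ∃ q, k = q + 2 := ⟨k - 2, by omega⟩
  simp only [show q + 2 - 1 = q + 1 by omega, show q + 2 - 2 = q by omega] at hn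
  -- vertices with few outgoing colours
  set A := Finset.univ.filter (fun v => q + 1 < (outColours r c v).ncard) with hA
  have hAc : A.card ≤ t l (q + 1) := card_many_out (t_mem l (q + 1)) hT hf hrb A (by simp [hA])
  set A' := Finset.univ.filter (fun v => ¬ q + 1 < (outColours r c v).ncard) with hA'
  have hcard : A.card + A'.card = n := by
    have := Finset.card_filter_add_card_filter_not (s := (Finset.univ : Finset (Fin n)))
      (fun v => q + 1 < (outColours r c v).ncard)
    rw [Finset.card_univ, Fintype.card_fin] at this
    rw [hA, hA']
    convert this
  have hcard2 := Finset.card_filter_add_card_filter_not (s := A')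
    (fun v => IsInRobust q r c v)
  have hbad : (A'.filter (fun v => ¬ IsInRobust q r c v)).card ≤ g l (q + 2) q := by
    by_contra! hcon
    obtain ⟨v, hv, hvr⟩ := sub_g (g_mem l (q + 2) q) hT hf hrb _ hcon (by
      intro v hv
      simp only [hA', Finset.mem_filter] at hv
      have := hv.1.2
      omega)
    exact (Finset.mem_filter.1 hv).2 hvr
  set R := A'.filter (fun v => IsInRobust q r c v) with hR
  set X := t l (q + 1) + 2 * (q + 1) * l * t l q with hXdef
  obtain ⟨v0, hv0, a, N, hNR, hX, hs⟩ := exists_mono_star (c := c) hT R (q + 1) X (by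
    intro v hv
    simp only [hR, hA', Finset.mem_filter] at hv
    have := hv.1.2
    omega) (by omega)
  obtain ⟨y0, hy1, hy2, hy3, hy4⟩ := (Finset.mem_filter.1 hv0).2 a
  have hy0 := RW_of_walk (c := c) y0 hy1
  rw [hy4] at hy0
  set D := List.ofFn (walkColours c y0) with hD
  have hDn : (D ++ [a]).Nodup := by
    rw [List.nodup_append]
    refine ⟨List.nodup_ofFn.2 hy2, by simp, ?_⟩
    intro b hb d hd
    simp only [List.mem_singleton] at hd
    subst hd
    obtain ⟨i, rfl⟩ := (List.mem_ofFn' _ _).1 hb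
    exact hy3 i
  set C := (D ++ [a]).toFinset with hC
  have hCc : C.card = q + 1 := by
    rw [hC, List.toFinset_card_of_nodup hDn]
    simp [hD]
  -- outgoing edges of `N` are coloured in `C`
  have hout : ∀ u ∈ N, ∀ w, r u w → c u w ∈ C := by
    intro u hu w huw
    by_contra hnot
    refine hrb (HasRainbow_of_RW (L := (D ++ [a]) ++ [c u w]) (v := y0 0) (w := w) ?_
      (by simp [hD]) ?_)
    · rw [RW_append]
      refine ⟨u, ?_, w, huw, rfl, rfl⟩
      rw [RW_append]
      exact ⟨v0, hy0, u, (hs u hu).1, (hs u hu).2, rfl⟩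
    · rw [List.nodup_append]
      refine ⟨hDn, by simp, ?_⟩
      intro b hb d hd
      simp only [List.mem_singleton] at hd
      subst hd
      rintro rfl
      exact hnot (List.mem_toFinset.2 hb)
  have hwalkC : ∀ {m : ℕ} (y : Fin (m + 1) → Fin n), IsWalk r y → (∀ i, y i ∈ N) →
      ∀ i, walkColours c y i ∈ C := fun y h1 h2 i => hout _ (h2 _) _ (h1 i)
  -- the exceptional sets
  set S := N.filter (fun v => ¬ ∃ y : Fin (q + 1 + 1) → Fin n, IsWalk r y ∧
    Function.Injective (walkColours c y) ∧ (∀ i, y i ∈ N) ∧ y 0 = v) with hS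
  have hSc : S.card ≤ t l (q + 1) := by
    by_contra! hcon
    obtain ⟨y, h1, h2, h3⟩ := sub_t (t_mem l (q + 1)) hT hf S hcon
    exact (Finset.mem_filter.1 (h3 0)).2
      ⟨y, h1, h2, fun i => (Finset.mem_filter.1 (h3 i)).1, rfl⟩
  let E : α → Fin n → Prop := fun b v => ∃ y : Fin (q + 1) → Fin n, IsWalk r y ∧
    Function.Injective (walkColours c y) ∧ (∀ i, y i ∈ N) ∧
    (∀ i, walkColours c y i ≠ b) ∧ y (Fin.last q) = v
  let F : α → Fin n → Prop := fun b v => ∃ y : Fin (q + 1) → Fin n, IsWalk r y ∧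
    Function.Injective (walkColours c y) ∧ (∀ i, y i ∈ N) ∧
    (∀ i, walkColours c y i ≠ b) ∧ y 0 = v
  have hEc : ∀ b, (N.filter (fun v => ¬ E b v)).card ≤ l * t l q := by
    intro b
    by_contra! hcon
    obtain ⟨y, h1, h2, h3, h4⟩ := sub_avoid hT hf b _ hcon
    exact (Finset.mem_filter.1 (h3 (Fin.last q))).2
      ⟨y, h1, h2, fun i => (Finset.mem_filter.1 (h3 i)).1, h4, rfl⟩
  have hFc : ∀ b, (N.filter (fun v => ¬ F b v)).card ≤ l * t l q := by
    intro b
    by_contra! hcon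
    obtain ⟨y, h1, h2, h3, h4⟩ := sub_avoid hT hf b _ hcon
    exact (Finset.mem_filter.1 (h3 0)).2
      ⟨y, h1, h2, fun i => (Finset.mem_filter.1 (h3 i)).1, h4, rfl⟩
  set U := S ∪ (C.biUnion (fun b => N.filter (fun v => ¬ E b v)) ∪
    C.biUnion (fun b => N.filter (fun v => ¬ F b v))) with hU
  have hUc : U.card ≤ X := by
    have e1 := Finset.card_biUnion_le_card_mul C (fun b => N.filter (fun v => ¬ E b v)) _
      (fun b _ => hEc b)
    have e2 := Finset.card_biUnion_le_card_mul C (fun b => N.filter (fun v => ¬ F b v)) _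
      (fun b _ => hFc b)
    rw [hCc] at e1 e2
    have e5 : 2 * (q + 1) * l * t l q = 2 * ((q + 1) * (l * t l q)) := by ring
    have e3 : U.card ≤ t l (q + 1) + ((q + 1) * (l * t l q) + (q + 1) * (l * t l q)) :=
      (Finset.card_union_le _ _).trans (Nat.add_le_add hSc
        ((Finset.card_union_le _ _).trans (Nat.add_le_add e1 e2)))
    omega
  obtain ⟨v, hvN, hvU⟩ := Finset.exists_mem_notMem_of_card_lt_card (lt_of_le_of_lt hUc hX)
  have hv1 : ∃ y : Fin (q + 1 + 1) → Fin n, IsWalk r y ∧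
      Function.Injective (walkColours c y) ∧ (∀ i, y i ∈ N) ∧ y 0 = v := by
    by_contra hno
    exact hvU (Finset.mem_union_left _ (Finset.mem_filter.2 ⟨hvN, hno⟩))
  have hv2 : ∀ b ∈ C, E b v := by
    intro b hb
    by_contra hno
    exact hvU (Finset.mem_union_right _ (Finset.mem_union_left _
      (Finset.mem_biUnion.2 ⟨b, hb, Finset.mem_filter.2 ⟨hvN, hno⟩⟩)))
  have hv3 : ∀ b ∈ C, F b v := by
    intro b hb
    by_contra hno
    exact hvU (Finset.mem_union_right _ (Finset.mem_union_right _
      (Finset.mem_biUnion.2 ⟨b, hb, Finset.mem_filter.2 ⟨hvN, hno⟩⟩)))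
  have hrange : ∀ b ∈ C, ∀ y : Fin (q + 1) → Fin n, IsWalk r y →
      Function.Injective (walkColours c y) → (∀ i, y i ∈ N) → (∀ i, walkColours c y i ≠ b) →
      Set.range (walkColours c y) = ↑C \ {b} := by
    intro b hb y h1 h2 h3 h4
    have hsub : Finset.univ.image (walkColours c y) ⊆ C.erase b := by
      intro x hx
      obtain ⟨i, -, rfl⟩ := Finset.mem_image.1 hx
      exact Finset.mem_erase.2 ⟨h4 i, hwalkC y h1 h3 i⟩
    have heq := Finset.eq_of_subset_of_card_le hsub (by
      rw [Finset.card_erase_of_mem hb, Finset.card_image_of_injective _ h2, hCc]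
      simp)
    have := congrArg (fun s : Finset α => (s : Set α)) heq
    simpa using this
  refine ⟨v, C, hCc, fun u => ⟨fun huv => ?_, fun hvu => hout v hvN u hvu⟩, fun b hb => ⟨?_, ?_⟩⟩
  · obtain ⟨y, h1, h2, h3, h4⟩ := hv1
    by_contra hnot
    have hsub : ∀ i, walkColours c y i ∈ C := hwalkC y h1 h3
    have hw := RW_of_walk (c := c) y h1
    rw [h4] at hw
    refine hrb (HasRainbow_of_RW (L := c u v :: List.ofFn (walkColours c y)) (v := u)
      ⟨v, huv, rfl, hw⟩ (by simp) ?_)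
    rw [List.nodup_cons]
    refine ⟨fun hmem => ?_, List.nodup_ofFn.2 h2⟩
    obtain ⟨i, hi⟩ := (List.mem_ofFn' _ _).1 hmem
    exact hnot (hi ▸ hsub i)
  · obtain ⟨y, h1, h2, h3, h4, h5⟩ := hv2 b hb
    exact ⟨y, h1, h2, hrange b hb y h1 h2 h3 h4, h5⟩
  · obtain ⟨y, h1, h2, h3, h4, h5⟩ := hv3 b hb
    exact ⟨y, h1, h2, hrange b hb y h1 h2 h3 h4, h5⟩
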